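/- For all integers p, k with 1 ≤ p ≤ k, the identity G_p^k = Ḡ_p^k − q_k·(1 − x_k)·(Ḡ_p^{k−1} − Ḡ_{p−1}^{k−1}) holds in ℤ[q_1, q_2, …, x_1, x_2, …]. -/

import Mathlib

open MvPolynomial Finset

noncomputable section

/-- The polynomial ring `ℤ[q_1, q_2, …, x_1, x_2, …]`; the variable `Sum.inl i` is `q_i`
and `Sum.inr i` is `x_i`. -/
abbrev P : Type := MvPolynomial (ℕ ⊕ ℕ) ℤ

/-- The variable `q_i`. -/
def qv (i : ℕ) : P := X (Sum.inl i)

/-- The variable `x_i`. -/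
def xv (i : ℕ) : P := X (Sum.inr i)

/-- The polynomial `F_p^k`, defined as `0` unless `0 ≤ p ≤ k`. -/
def Fp (p k : ℤ) : P :=
  if 0 ≤ p ∧ p ≤ k then
    ∑ I ∈ (Finset.Icc 1 k.toNat).powersetCard p.toNat,
      (∏ i ∈ I, (1 - xv i)) * ∏ i ∈ I.filter (fun i => i + 1 ∉ I), (1 - qv i)
  else 0

/-- The substitution `q_k ↦ 0`. -/
def setQ (k : ℕ) : P →ₐ[ℤ] P :=
  aeval (fun v => if v = Sum.inl k then 0 else X v)

/-- The polynomial `Ê_p^k = Σ_{i=0}^p (−1)^i C(k−i, p−i) F_i^k`, defined as `0` unless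
`0 ≤ p ≤ k`. -/
def Ehat (p k : ℤ) : P :=
  if 0 ≤ p ∧ p ≤ k then
    ∑ i ∈ Finset.range (p.toNat + 1),
      (-1 : P) ^ i * (Nat.choose (k.toNat - i) (p.toNat - i) : P) * Fp (i : ℤ) k
  else 0

/-- `Ē_p^k`, i.e. `Ê_p^k` with `q_k` set to `0`. -/
def Ebar (p k : ℤ) : P := setQ k.toNat (Ehat p k)

/-- The polynomial `G_p^k`: `G_0^k = 1`, and for `p ≥ 1`,
`G_p^k = Σ_{i=p}^k (−1)^{i−p} C(i−1, p−1) Ê_i^k`; it is `0` unless `0 ≤ p ≤ k`. -/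
def Gq (p k : ℤ) : P :=
  if 0 ≤ p ∧ p ≤ k then
    if p = 0 then 1
    else
      ∑ i ∈ Finset.Icc p k,
        (-1 : P) ^ (i - p).toNat * (Nat.choose (i - 1).toNat (p - 1).toNat : P) * Ehat i k
  else 0

/-- `Ḡ_p^k`, i.e. `G_p^k` with `q_k` set to `0`. -/
def Gbar (p k : ℤ) : P := setQ k.toNat (Gq p k)

/-- The summand of `F_p^k` belonging to the index set `I`. -/
def weight (I : Finset ℕ) : P :=
  (∏ i ∈ I, (1 - xv i)) * ∏ i ∈ I.filter (fun i => i + 1 ∉ I), (1 - qv i)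

/-- `F_p^k` for natural number indices. -/
def natF (p k : ℕ) : P := ∑ I ∈ (Finset.Icc 1 k).powersetCard p, weight I

/-- `Ê_p^k` for natural number indices. -/
def natE (p k : ℕ) : P :=
  ∑ i ∈ Finset.range (p + 1), (-1 : P) ^ i * (Nat.choose (k - i) (p - i) : P) * natF i k

/-- The alternating binomial transform taking `Ê_0^k, Ê_1^k, …` to `G_0^k, G_1^k, …`. -/
def binomTransform (e : ℕ → P) (k : ℕ) : ℕ → P
  | 0 => 1
  | p + 1 => ∑ i ∈ Finset.range k, (-1 : P) ^ (i + p) * (Nat.choose i p : P) * e (i + 1)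

lemma setQ_qv (k i : ℕ) : setQ k (qv i) = if i = k then 0 else qv i := by
  simp [setQ, qv]

lemma setQ_xv (k i : ℕ) : setQ k (xv i) = xv i := by
  simp [setQ, xv]

lemma natF_zero (k : ℕ) : natF 0 k = 1 := by
  simp [natF, weight]

lemma natF_eq_zero {p k : ℕ} (h : k < p) : natF p k = 0 := by
  rw [natF, Finset.powersetCard_eq_empty.2 (by simpa using h), Finset.sum_empty]

lemma Fp_natCast (p k : ℕ) : Fp p k = natF p k := by
  rcases lt_or_ge k p with h | h
  · rw [natF_eq_zero h, Fp, if_neg (by omega)]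
  · rw [Fp, if_pos (by omega)]
    simp [natF, weight]

lemma setQ_weight_of_notMem {k : ℕ} {I : Finset ℕ} (h : k ∉ I) :
    setQ k (weight I) = weight I := by
  simp only [weight, map_mul, map_prod, map_sub, map_one, setQ_qv, setQ_xv]
  congr 1
  refine Finset.prod_congr rfl fun i hi => ?_
  rw [if_neg]
  rintro rfl
  exact h (Finset.mem_filter.1 hi).1

lemma weight_insert {k : ℕ} {J : Finset ℕ} (hJ : J ⊆ Finset.Icc 1 k) :
    weight (insert (k + 1) J) =
      (1 - qv (k + 1)) * (1 - xv (k + 1)) * setQ k (weight J) := by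
  have hmem : ∀ i ∈ J, i ≤ k := fun i hi => (Finset.mem_Icc.1 (hJ hi)).2
  have hk : k + 1 ∉ J := fun h => by have := hmem _ h; omega
  have hk' : k + 2 ∉ J := fun h => by have := hmem _ h; omega
  have hfilter : (insert (k + 1) J).filter (fun i => i + 1 ∉ insert (k + 1) J) =
      insert (k + 1) ((J.filter (fun i => i + 1 ∉ J)).filter (fun i => i ≠ k)) := by
    ext i
    simp only [Finset.mem_filter, Finset.mem_insert]
    grind
  have hprod : setQ k (∏ i ∈ J.filter (fun i => i + 1 ∉ J), (1 - qv i)) =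
      ∏ i ∈ (J.filter (fun i => i + 1 ∉ J)).filter (fun i => i ≠ k), (1 - qv i) := by
    rw [map_prod, Finset.prod_filter (fun i => i ≠ k)]
    refine Finset.prod_congr rfl fun i _ => ?_
    by_cases h : i = k <;> simp [setQ_qv, h]
  rw [weight, hfilter, Finset.prod_insert hk, Finset.prod_insert (by simp [hk]), weight,
    map_mul, hprod]
  simp only [map_prod, map_sub, map_one, setQ_xv]
  ring

lemma natF_succ_succ (p k : ℕ) :
    natF (p + 1) (k + 1) = natF (p + 1) k +
      (1 - qv (k + 1)) * (1 - xv (k + 1)) * setQ k (natF p k) := by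
  have hk : k + 1 ∉ Finset.Icc 1 k := by simp
  have hIcc : Finset.Icc 1 (k + 1) = insert (k + 1) (Finset.Icc 1 k) := by
    ext i
    simp only [Finset.mem_Icc, Finset.mem_insert]
    omega
  have hnot : ∀ {n : ℕ} {J : Finset ℕ}, J ∈ (Finset.Icc 1 k).powersetCard n → k + 1 ∉ J :=
    fun hJ h => hk ((Finset.mem_powersetCard.1 hJ).1 h)
  rw [natF, hIcc, Finset.powersetCard_succ_insert hk, Finset.sum_union, Finset.sum_image]
  · rw [natF, natF, map_sum, Finset.mul_sum]
    congr 1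
    exact Finset.sum_congr rfl fun J hJ => weight_insert (Finset.mem_powersetCard.1 hJ).1
  · intro I hI J hJ hIJ
    rw [← Finset.erase_insert (hnot hI), ← Finset.erase_insert (hnot hJ)]
    exact congrArg (fun S => S.erase (k + 1)) hIJ
  · rw [Finset.disjoint_left]
    intro I hI hI'
    obtain ⟨J, -, rfl⟩ := Finset.mem_image.1 hI'
    exact hnot hI (Finset.mem_insert_self _ _)

lemma setQ_succ_natF (p k : ℕ) : setQ (k + 1) (natF p k) = natF p k := by
  rw [natF, map_sum]
  refine Finset.sum_congr rfl fun I hI => setQ_weight_of_notMem fun h => ?_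
  have := Finset.mem_Icc.1 ((Finset.mem_powersetCard.1 hI).1 h)
  omega

lemma setQ_succ_setQ_natF (p k : ℕ) :
    setQ (k + 1) (setQ k (natF p k)) = setQ k (natF p k) := by
  have hcomm : (setQ (k + 1)).comp (setQ k) = (setQ k).comp (setQ (k + 1)) := by
    refine MvPolynomial.algHom_ext fun v => ?_
    rcases v with i | i
    · change setQ (k + 1) (setQ k (qv i)) = setQ k (setQ (k + 1) (qv i))
      simp only [setQ_qv]
      split_ifs <;> simp_all [setQ_qv]
    · change setQ (k + 1) (setQ k (xv i)) = setQ k (setQ (k + 1) (xv i))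
      simp only [setQ_xv]
  calc setQ (k + 1) (setQ k (natF p k)) = setQ k (setQ (k + 1) (natF p k)) :=
        DFunLike.congr_fun hcomm _
    _ = setQ k (natF p k) := by rw [setQ_succ_natF]

lemma natF_eq_setQ_sub (p k : ℕ) :
    natF (p + 1) (k + 1) = setQ (k + 1) (natF (p + 1) (k + 1)) -
      qv (k + 1) * (1 - xv (k + 1)) * setQ k (natF p k) := by
  rw [natF_succ_succ]
  simp only [map_add, map_mul, map_sub, map_one, setQ_succ_natF, setQ_succ_setQ_natF, setQ_xv,
    setQ_qv, if_true]
  ring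

lemma natE_zero (k : ℕ) : natE 0 k = 1 := by
  simp [natE, natF_zero]

lemma Ehat_natCast (p k : ℕ) : Ehat p k = natE p k := by
  rcases lt_or_ge k p with h | h
  · rw [Ehat, if_neg (by omega), natE]
    refine (Finset.sum_eq_zero fun i _ => ?_).symm
    rcases lt_or_ge k i with hi | hi
    · rw [natF_eq_zero hi, mul_zero]
    · rw [Nat.choose_eq_zero_of_lt (by omega)]
      simp
  · rw [Ehat, if_pos (by omega)]
    simp [natE, Fp_natCast]

lemma natE_eq_setQ_add (p k : ℕ) :
    natE (p + 1) (k + 1) = setQ (k + 1) (natE (p + 1) (k + 1)) +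
      qv (k + 1) * (1 - xv (k + 1)) * setQ k (natE p k) := by
  simp only [natE, map_sum, map_mul, map_pow, map_neg, map_one, map_natCast]
  rw [Finset.sum_range_succ', Finset.sum_range_succ' _ (p + 1), Finset.mul_sum, natF_zero,
    map_one, add_right_comm, ← Finset.sum_add_distrib]
  congr 1
  refine Finset.sum_congr rfl fun i _ => ?_
  rw [Nat.add_sub_add_right, Nat.add_sub_add_right]
  linear_combination
    (-1 : P) ^ (i + 1) * (Nat.choose (k - i) (p - i) : P) * natF_eq_setQ_sub i k

lemma map_binomTransform (φ : P →ₐ[ℤ] P) (e : ℕ → P) (k p : ℕ) :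
    φ (binomTransform e k p) = binomTransform (fun i => φ (e i)) k p := by
  cases p <;> simp [binomTransform]

lemma sum_choose_eq_binomTransform_sub (e : ℕ → P) (he : e 0 = 1) (k p : ℕ) :
    ∑ i ∈ Finset.range (k + 1), (-1 : P) ^ (i + p) * (Nat.choose i p : P) * e i =
      binomTransform e k p - binomTransform e k (p + 1) := by
  rw [Finset.sum_range_succ', he]
  cases p with
  | zero =>
    simp only [binomTransform, sub_eq_add_neg, ← Finset.sum_neg_distrib]
    rw [add_comm]
    congr 1
    · simp
    · refine Finset.sum_congr rfl fun i _ => ?_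
      simp only [Nat.choose_zero_right]
      ring
  | succ m =>
    simp only [binomTransform, ← Finset.sum_sub_distrib]
    rw [Nat.choose_zero_succ, Nat.cast_zero, mul_zero, zero_mul, add_zero]
    refine Finset.sum_congr rfl fun i _ => ?_
    rw [Nat.choose_succ_succ]
    push_cast
    ring

lemma Gq_natCast (p k : ℕ) : Gq p k = binomTransform (fun i => natE i k) k p := by
  cases p with
  | zero => simp [Gq, binomTransform]
  | succ m =>
    rw [binomTransform]
    rcases lt_or_ge k (m + 1) with h | h
    · rw [Gq, if_neg (by omega)]
      refine (Finset.sum_eq_zero fun i hi => ?_).symm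
      rw [Nat.choose_eq_zero_of_lt (by have := Finset.mem_range.1 hi; omega)]
      simp
    · rw [Gq, if_pos (by omega), if_neg (by omega)]
      have hsub : Finset.Ico m k ⊆ Finset.range k := fun i hi => by
        simp only [Finset.mem_Ico, Finset.mem_range] at hi ⊢
        omega
      rw [← Finset.sum_subset hsub]
      · refine Finset.sum_bij' (fun i _ => (i - 1).toNat) (fun i _ => (i : ℤ) + 1) ?_ ?_ ?_ ?_ ?_
        · intro i hi
          simp only [Finset.mem_Icc, Finset.mem_Ico] at hi ⊢
          omega
        · intro i hi
          simp only [Finset.mem_Icc, Finset.mem_Ico] at hi ⊢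
          omega
        · intro i hi
          simp only [Finset.mem_Icc] at hi
          omega
        · intro i hi
          simp
        · intro i hi
          simp only [Finset.mem_Icc] at hi
          obtain ⟨j, rfl⟩ : ∃ j : ℕ, i = ((m + j + 1 : ℕ) : ℤ) :=
            ⟨(i - m - 1).toNat, by omega⟩
          rw [Ehat_natCast,
            show (((m + j + 1 : ℕ) : ℤ) - ((m + 1 : ℕ) : ℤ)).toNat = j by omega,
            show (((m + j + 1 : ℕ) : ℤ) - 1).toNat = m + j by omega,
            show (((m + 1 : ℕ) : ℤ) - 1).toNat = m by omega,
            show m + j + m = j + 2 * m by ring, pow_add, pow_mul]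
          simp
      · intro i hi hi'
        simp only [Finset.mem_Ico, Finset.mem_range] at hi hi'
        rw [Nat.choose_eq_zero_of_lt (by omega)]
        simp

lemma Gbar_natCast (p k : ℕ) :
    Gbar p k = binomTransform (fun i => setQ k (natE i k)) k p := by
  rw [Gbar, Gq_natCast, Int.toNat_natCast, map_binomTransform]

/-- For all integers `1 ≤ p ≤ k`,
`G_p^k = Ḡ_p^k − q_k·(1 − x_k)·(Ḡ_p^{k−1} − Ḡ_{p−1}^{k−1})`. -/
theorem statement10 (p k : ℤ) (hp : 1 ≤ p) (hpk : p ≤ k) :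
    Gq p k = Gbar p k
      - qv k.toNat * (1 - xv k.toNat) * (Gbar p (k - 1) - Gbar (p - 1) (k - 1)) := by
  obtain ⟨m, rfl⟩ : ∃ m : ℕ, p = ((m + 1 : ℕ) : ℤ) := ⟨(p - 1).toNat, by omega⟩
  obtain ⟨n, rfl⟩ : ∃ n : ℕ, k = ((n + 1 : ℕ) : ℤ) := ⟨(k - 1).toNat, by omega⟩
  rw [show ((m + 1 : ℕ) : ℤ) - 1 = (m : ℕ) by omega,
    show ((n + 1 : ℕ) : ℤ) - 1 = (n : ℕ) by omega, Int.toNat_natCast, Gq_natCast,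
    Gbar_natCast, Gbar_natCast, Gbar_natCast]
  have hsum := sum_choose_eq_binomTransform_sub (fun i => setQ n (natE i n))
    (by rw [natE_zero, map_one]) n m
  rw [← neg_sub (binomTransform (fun i => setQ n (natE i n)) n m), ← hsum, mul_neg,
    sub_neg_eq_add, binomTransform, binomTransform, Finset.mul_sum, ← Finset.sum_add_distrib]
  refine Finset.sum_congr rfl fun i _ => ?_
  linear_combination (-1 : P) ^ (i + m) * (Nat.choose i m : P) * natE_eq_setQ_add i n
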